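/- Let Φ be a Euclidean ring. An automorphism φ of Φ[x₁,x₂] is tame if and only if there is a finite sequence of elementary transformations φ = φ₀ → φ₁ → ⋯ → φ_n such that D(φ₀) ≻ D(φ₁) ≻ ⋯ ≻ D(φ_n) and D(φ_n) = (x₁, x₂, 2e), where e = |1|. -/

import Mathlib

open MvPolynomial

/-- The group of `Φ`-algebra automorphisms of `Φ[x₁,x₂]`. -/
abbrev PolyAut (Φ : Type*) [CommRing Φ] :=
  MvPolynomial (Fin 2) Φ ≃ₐ[Φ] MvPolynomial (Fin 2) Φ

/-- `Φ` together with `ν` is a Euclidean ring: an integral domain, not a field, with a norm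
`ν` on nonzero elements such that (E1) `ν a ≤ ν (a*b)` with equality iff `b` is a unit, and
(E2) division with remainder holds. -/
structure IsEuclideanNorm (Φ : Type*) [CommRing Φ] [IsDomain Φ] (ν : Φ → ℕ) : Prop where
  not_field : ¬ IsField Φ
  norm_le : ∀ a b : Φ, a ≠ 0 → b ≠ 0 → ν a ≤ ν (a * b)
  norm_eq_iff_unit : ∀ a b : Φ, a ≠ 0 → b ≠ 0 → (ν (a * b) = ν a ↔ IsUnit b)
  division : ∀ a b : Φ, b ≠ 0 → ∃ q r : Φ, a = b * q + r ∧ (r = 0 ∨ ν r < ν b)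

/-- The monomial `x₁^l x₂^m` is encoded by the pair `(l + m, l)`; the lexicographic order on
these pairs is exactly the order `u < v` iff `deg u < deg v`, or `deg u = deg v` and
`deg_{x₁} u < deg_{x₁} v`. -/
def mkey (d : Fin 2 →₀ ℕ) : ℕ ×ₗ ℕ := toLex (d 0 + d 1, d 0)

/-- The key of the leading monomial of `f`: the largest key of a monomial in the support. -/
noncomputable def leadKey {Φ : Type*} [CommRing Φ] (f : MvPolynomial (Fin 2) Φ) : ℕ ×ₗ ℕ :=
  f.support.sup mkey

/-- The leading monomial `f̄` of `f` (as an exponent vector). -/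
noncomputable def leadMon {Φ : Type*} [CommRing Φ] (f : MvPolynomial (Fin 2) Φ) :
    Fin 2 →₀ ℕ :=
  Finsupp.single 0 (ofLex (leadKey f)).2 +
    Finsupp.single 1 ((ofLex (leadKey f)).1 - (ofLex (leadKey f)).2)

/-- The leading coefficient `lc f` of `f`. -/
noncomputable def lc {Φ : Type*} [CommRing Φ] (f : MvPolynomial (Fin 2) Φ) : Φ :=
  f.coeff (leadMon f)

/-- The leading term `f′ = lc(f)·f̄` of `f`. -/
noncomputable def leadTerm {Φ : Type*} [CommRing Φ] (f : MvPolynomial (Fin 2) Φ) :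
    MvPolynomial (Fin 2) Φ :=
  monomial (leadMon f) (lc f)

/-- The value `D(φ) = (u, v, ν(lc f₁) + ν(lc f₂)) ∈ W² × ℕ` of an automorphism
`φ = (f₁, f₂)`, where `{u, v} = {f̄₁, f̄₂}`, `u ≥ v`, monomials being encoded by their keys,
and `W² × ℕ` carries the lexicographic order. -/
noncomputable def DAut {Φ : Type*} [CommRing Φ] (ν : Φ → ℕ) (φ : PolyAut Φ) :
    Lex ((ℕ ×ₗ ℕ) × Lex ((ℕ ×ₗ ℕ) × ℕ)) :=
  toLex (max (leadKey (φ (X 0))) (leadKey (φ (X 1))),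
    toLex (min (leadKey (φ (X 0))) (leadKey (φ (X 1))),
      ν (lc (φ (X 0))) + ν (lc (φ (X 1)))))

/-- The value `(x₁, x₂, 2e)` where `e = ν 1`. -/
def DId (e : ℕ) : Lex ((ℕ ×ₗ ℕ) × Lex ((ℕ ×ₗ ℕ) × ℕ)) :=
  toLex (toLex (1, 1), toLex (toLex (1, 0), 2 * e))

/-- `ψ` is obtained from `θ` by a single elementary transformation: one component `fᵢ` of
`θ = (f₁, f₂)` is replaced by `αfᵢ + g` with `α` a unit and `g` in the `Φ`-subalgebra
generated by the other component. -/
def ElemStep {Φ : Type*} [CommRing Φ] (θ ψ : PolyAut Φ) : Prop :=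
  (∃ (α : Φˣ) (g : MvPolynomial (Fin 2) Φ), g ∈ Algebra.adjoin Φ {θ (X 1)} ∧
      ψ (X 0) = C (α : Φ) * θ (X 0) + g ∧ ψ (X 1) = θ (X 1)) ∨
  (∃ (α : Φˣ) (g : MvPolynomial (Fin 2) Φ), g ∈ Algebra.adjoin Φ {θ (X 0)} ∧
      ψ (X 0) = θ (X 0) ∧ ψ (X 1) = C (α : Φ) * θ (X 1) + g)

/-- `θ` admits an elementary `D`-reduction: some elementary transformation of `θ` yields an
automorphism `ψ` with `D(ψ) ≺ D(θ)`. -/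
def ElemDReducible {Φ : Type*} [CommRing Φ] (ν : Φ → ℕ) (θ : PolyAut Φ) : Prop :=
  ∃ ψ : PolyAut Φ, ElemStep θ ψ ∧ DAut ν ψ < DAut ν θ

/-- An automorphism of `Φ[x₁,x₂]` is elementary if it has the form
`(x₁ ↦ αx₁ + f(x₂), x₂ ↦ x₂)` or `(x₁ ↦ x₁, x₂ ↦ βx₂ + g(x₁))` with `α, β` units. -/
def IsElementary {Φ : Type*} [CommRing Φ] (σ : PolyAut Φ) : Prop :=
  (∃ (α : Φˣ) (f : MvPolynomial (Fin 2) Φ), f ∈ Algebra.adjoin Φ {(X 1 : MvPolynomial (Fin 2) Φ)} ∧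
      σ (X 0) = C (α : Φ) * X 0 + f ∧ σ (X 1) = X 1) ∨
  (∃ (β : Φˣ) (g : MvPolynomial (Fin 2) Φ), g ∈ Algebra.adjoin Φ {(X 0 : MvPolynomial (Fin 2) Φ)} ∧
      σ (X 0) = X 0 ∧ σ (X 1) = C (β : Φ) * X 1 + g)

/-- The subgroup of tame automorphisms of `Φ[x₁,x₂]`, generated by the elementary ones. -/
noncomputable def TameSubgroup (Φ : Type*) [CommRing Φ] : Subgroup (PolyAut Φ) :=
  Subgroup.closure {σ | IsElementary σ}

section LeadingTerms

open MonomialOrder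

lemma mkey_le_mkey_iff (d e : Fin 2 →₀ ℕ) : mkey d ≤ mkey e ↔ d ≼[degLex] e := by
  rw [degLex_le_iff, Finsupp.DegLex.le_iff, le_iff_eq_or_lt (a := toLex (ofDegLex (toDegLex d))),
    Finsupp.Lex.lt_iff, mkey, mkey, Prod.Lex.toLex_le_toLex]
  simp only [Finsupp.degree_eq_sum, Fin.sum_univ_two, ofDegLex_toDegLex, Fin.exists_fin_two]
  constructor
  · rintro (h | ⟨h, h'⟩)
    · exact Or.inl h
    · refine Or.inr ⟨h, ?_⟩
      rcases h'.lt_or_eq with h' | h'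
      · exact Or.inr (Or.inl ⟨fun j hj => absurd hj (Fin.not_lt_zero j), h'⟩)
      · left
        congr 1
        ext i
        fin_cases i
        · exact h'
        · simp; omega
  · rintro (h | ⟨h, h' | ⟨-, h'⟩ | ⟨h', h''⟩⟩)
    · exact Or.inl h
    · have : d = e := toLex.injective h'
      subst this
      exact Or.inr ⟨rfl, le_rfl⟩
    · exact Or.inr ⟨h, (show d 0 < e 0 from h').le⟩
    · exact Or.inr ⟨h, (show d 0 = e 0 from h' 0 (by simp)).le⟩

lemma mkey_lt_mkey_iff (d e : Fin 2 →₀ ℕ) : mkey d < mkey e ↔ d ≺[degLex] e := by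
  rw [← not_le, mkey_le_mkey_iff, not_le]

lemma mkey_injective : Function.Injective mkey := fun d e h =>
  degLex.toSyn.injective <|
    le_antisymm ((mkey_le_mkey_iff d e).1 h.le) ((mkey_le_mkey_iff e d).1 h.ge)

lemma mkey_zero : mkey 0 = ⊥ := rfl

variable {Φ : Type*} [CommRing Φ]

lemma leadKey_eq_mkey_degree (f : MvPolynomial (Fin 2) Φ) :
    leadKey f = mkey (degLex.degree f) := by
  apply le_antisymm
  · exact Finset.sup_le fun d hd => (mkey_le_mkey_iff _ _).2 (degLex.le_degree hd)
  · rcases eq_or_ne f 0 with rfl | hf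
    · simp [degree_zero, mkey_zero]
    · exact Finset.le_sup (f := mkey) (degLex.degree_mem_support hf)

lemma leadMon_eq_degree (f : MvPolynomial (Fin 2) Φ) : leadMon f = degLex.degree f := by
  rw [leadMon, leadKey_eq_mkey_degree]
  ext i
  fin_cases i <;> simp [mkey]

lemma lc_eq_leadingCoeff (f : MvPolynomial (Fin 2) Φ) : lc f = degLex.leadingCoeff f := by
  rw [lc, leadMon_eq_degree, leadingCoeff]

lemma leadMon_eq_of_leadKey_eq {f g : MvPolynomial (Fin 2) Φ} (h : leadKey f = leadKey g) :
    leadMon f = leadMon g := by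
  rw [leadMon, leadMon, h]

lemma lc_ne_zero {f : MvPolynomial (Fin 2) Φ} (hf : f ≠ 0) : lc f ≠ 0 := by
  rwa [lc_eq_leadingCoeff, degLex.leadingCoeff_ne_zero_iff]

lemma leadKey_C (c : Φ) : leadKey (C c : MvPolynomial (Fin 2) Φ) = ⊥ := by
  rw [leadKey_eq_mkey_degree, degree_C, mkey_zero]

lemma eq_C_of_leadKey_eq_bot {f : MvPolynomial (Fin 2) Φ} (hf : leadKey f = ⊥) :
    ∃ c, f = C c := by
  rw [leadKey_eq_mkey_degree, ← mkey_zero] at hf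
  exact ⟨_, degLex.eq_C_of_degree_eq_zero (mkey_injective hf)⟩

lemma coeff_eq_zero_of_leadKey_lt {f : MvPolynomial (Fin 2) Φ} {d : Fin 2 →₀ ℕ}
    (h : leadKey f < mkey d) : coeff d f = 0 := by
  rw [leadKey_eq_mkey_degree, mkey_lt_mkey_iff] at h
  exact degLex.coeff_eq_zero_of_lt h

lemma mkey_leadMon (f : MvPolynomial (Fin 2) Φ) : mkey (leadMon f) = leadKey f := by
  rw [leadMon_eq_degree, leadKey_eq_mkey_degree]

lemma leadKey_add_le (f g : MvPolynomial (Fin 2) Φ) :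
    leadKey (f + g) ≤ max (leadKey f) (leadKey g) := by
  classical
  refine Finset.sup_le fun d hd => ?_
  rcases Finset.mem_union.1 (support_add hd) with h | h
  · exact le_max_of_le_left (Finset.le_sup (f := mkey) h)
  · exact le_max_of_le_right (Finset.le_sup (f := mkey) h)

lemma leadKey_add_of_lt {f g : MvPolynomial (Fin 2) Φ} (h : leadKey g < leadKey f) :
    leadKey (f + g) = leadKey f := by
  rw [leadKey_eq_mkey_degree, leadKey_eq_mkey_degree, mkey_lt_mkey_iff] at h
  rw [leadKey_eq_mkey_degree, leadKey_eq_mkey_degree, degLex.degree_add_of_lt h]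

lemma lc_add_of_lt {f g : MvPolynomial (Fin 2) Φ} (h : leadKey g < leadKey f) :
    lc (f + g) = lc f := by
  rw [leadKey_eq_mkey_degree, leadKey_eq_mkey_degree, mkey_lt_mkey_iff] at h
  rw [lc_eq_leadingCoeff, lc_eq_leadingCoeff, degLex.leadingCoeff_add_of_lt h]

lemma leadKey_C_mul_le (a : Φ) (f : MvPolynomial (Fin 2) Φ) : leadKey (C a * f) ≤ leadKey f := by
  refine Finset.sup_le fun d hd => Finset.le_sup (f := mkey) ?_
  rw [mem_support_iff, coeff_C_mul] at hd
  exact mem_support_iff.2 (right_ne_zero_of_mul hd)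

lemma leadKey_lt_of_coeff_eq_zero {f g : MvPolynomial (Fin 2) Φ} (hg : g ≠ 0)
    (h : leadKey g ≤ leadKey f) (h0 : coeff (leadMon f) g = 0) : leadKey g < leadKey f := by
  refine h.lt_of_ne fun heq => lc_ne_zero hg ?_
  rw [lc, leadMon_eq_of_leadKey_eq heq, h0]

lemma leadKey_eq_of_coeff_ne_zero {f g : MvPolynomial (Fin 2) Φ}
    (h : leadKey g ≤ leadKey f) (h0 : coeff (leadMon f) g ≠ 0) : leadKey g = leadKey f := by
  refine h.eq_of_not_lt fun hlt => h0 (coeff_eq_zero_of_leadKey_lt ?_)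
  rwa [mkey_leadMon]

variable [IsDomain Φ]

lemma leadKey_C_mul {a : Φ} (ha : a ≠ 0) (f : MvPolynomial (Fin 2) Φ) :
    leadKey (C a * f) = leadKey f := by
  simp only [leadKey, support, ← smul_eq_C_mul]
  congr 1
  exact support_smul_eq ha f

lemma lc_C_mul {a : Φ} (ha : a ≠ 0) (f : MvPolynomial (Fin 2) Φ) :
    lc (C a * f) = a * lc f := by
  rw [lc, leadMon_eq_of_leadKey_eq (leadKey_C_mul ha f), coeff_C_mul, lc]

lemma aeval_degree {f : MvPolynomial (Fin 2) Φ} (hf : leadKey f ≠ ⊥) {p : Polynomial Φ}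
    (hp : p ≠ 0) : Polynomial.aeval f p ≠ 0 ∧
      degLex.degree (Polynomial.aeval f p) = p.natDegree • degLex.degree f := by
  have hd : degLex.degree f ≠ 0 := fun h => hf (by rw [leadKey_eq_mkey_degree, h, mkey_zero])
  have hf0 : f ≠ 0 := degLex.ne_zero_of_degree_ne_zero hd
  induction hn : p.natDegree generalizing p with
  | zero =>
    rw [Polynomial.eq_C_of_natDegree_eq_zero hn] at hp ⊢
    rw [Polynomial.aeval_C, algebraMap_eq]
    exact ⟨by simpa using hp, by simp [degree_C]⟩
  | succ n ih =>
    have hq : p.divX.natDegree = n := by rw [Polynomial.natDegree_divX_eq_natDegree_tsub_one]; omega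
    have hq0 : p.divX ≠ 0 := fun h => by
      rw [Polynomial.divX_eq_zero_iff] at h
      rw [h, Polynomial.natDegree_C] at hn
      omega
    obtain ⟨h1, h2⟩ := ih hq0 hq
    have h3 : Polynomial.aeval f p = Polynomial.aeval f p.divX * f + C (p.coeff 0) := by
      conv_lhs => rw [← Polynomial.divX_mul_X_add p]
      simp [algebraMap_eq]
    have h4 : degLex.degree (Polynomial.aeval f p.divX * f) = (n + 1) • degLex.degree f := by
      rw [degLex.degree_mul h1 hf0, h2, succ_nsmul]
    have h5 : degLex.degree (Polynomial.aeval f p) = (n + 1) • degLex.degree f := by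
      rw [h3, degLex.degree_add_of_lt, h4]
      rw [degree_C, h4, map_zero, degLex.toSyn_lt_iff_ne_zero]
      simpa using hd
    refine ⟨degLex.ne_zero_of_degree_ne_zero ?_, h5⟩
    rw [h5]
    simpa using hd

lemma leadKey_le_leadKey_aeval {f : MvPolynomial (Fin 2) Φ} (hf : leadKey f ≠ ⊥)
    {p : Polynomial Φ} (hp : 1 ≤ p.natDegree) : leadKey f ≤ leadKey (Polynomial.aeval f p) := by
  have hp0 : p ≠ 0 := by rintro rfl; simp at hp
  rw [leadKey_eq_mkey_degree, leadKey_eq_mkey_degree, mkey_le_mkey_iff, (aeval_degree hf hp0).2]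
  apply degLex.toSyn_monotone
  exact le_self_nsmul zero_le (by omega)

lemma leadKey_lt_leadKey_aeval {f : MvPolynomial (Fin 2) Φ} (hf : leadKey f ≠ ⊥)
    {p : Polynomial Φ} (hp : 2 ≤ p.natDegree) : leadKey f < leadKey (Polynomial.aeval f p) := by
  have hp0 : p ≠ 0 := by rintro rfl; simp at hp
  refine (leadKey_le_leadKey_aeval hf (by omega)).lt_of_ne fun h => hf ?_
  rw [leadKey_eq_mkey_degree, leadKey_eq_mkey_degree, (aeval_degree hf hp0).2] at h
  have h' := mkey_injective h
  have : degLex.degree f = 0 := by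
    ext i
    have := DFunLike.congr_fun h' i
    simp only [Finsupp.smul_apply, smul_eq_mul] at this
    simp only [Finsupp.coe_zero, Pi.zero_apply]
    nlinarith
  rw [leadKey_eq_mkey_degree, this, mkey_zero]

end LeadingTerms

section Automorphisms

variable {Φ : Type*} [CommRing Φ]

/-- The automorphism `(f₂, f₁)` obtained from `θ = (f₁, f₂)`. -/
noncomputable def swapAut (θ : PolyAut Φ) : PolyAut Φ :=
  (renameEquiv Φ (Equiv.swap (0 : Fin 2) 1)).trans θ

@[simp] lemma swapAut_X_zero (θ : PolyAut Φ) : swapAut θ (X 0) = θ (X 1) := by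
  simp [swapAut]

@[simp] lemma swapAut_X_one (θ : PolyAut Φ) : swapAut θ (X 1) = θ (X 0) := by
  simp [swapAut]

lemma polyAut_ext {θ ψ : PolyAut Φ} (h0 : θ (X 0) = ψ (X 0)) (h1 : θ (X 1) = ψ (X 1)) :
    θ = ψ := by
  have : (θ : MvPolynomial (Fin 2) Φ →ₐ[Φ] MvPolynomial (Fin 2) Φ) = ψ := by
    ext1 i
    fin_cases i
    · exact h0
    · exact h1
  exact AlgEquiv.ext fun f => DFunLike.congr_fun this f

@[simp] lemma swapAut_swapAut (θ : PolyAut Φ) : swapAut (swapAut θ) = θ :=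
  polyAut_ext (by simp) (by simp)

lemma dAut_swapAut (ν : Φ → ℕ) (θ : PolyAut Φ) : DAut ν (swapAut θ) = DAut ν θ := by
  simp only [DAut, swapAut_X_zero, swapAut_X_one, max_comm, min_comm, add_comm]

/-- `ψ = (α f₁ + p(f₂), f₂)` where `θ = (f₁, f₂)`. -/
def IsFstStep (α : Φˣ) (p : Polynomial Φ) (θ ψ : PolyAut Φ) : Prop :=
  ψ (X 0) = C (α : Φ) * θ (X 0) + Polynomial.aeval (θ (X 1)) p ∧ ψ (X 1) = θ (X 1)

lemma elemStep_iff {θ ψ : PolyAut Φ} : ElemStep θ ψ ↔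
    (∃ α p, IsFstStep α p θ ψ) ∨ ∃ α p, IsFstStep α p (swapAut θ) (swapAut ψ) := by
  simp only [ElemStep, IsFstStep, Algebra.adjoin_singleton_eq_range_aeval, AlgHom.mem_range,
    swapAut_X_zero, swapAut_X_one]
  constructor
  · rintro (⟨α, _, ⟨p, rfl⟩, h⟩ | ⟨α, _, ⟨p, rfl⟩, h⟩)
    · exact Or.inl ⟨α, p, h⟩
    · exact Or.inr ⟨α, p, h.symm⟩
  · rintro (⟨α, p, h⟩ | ⟨α, p, h⟩)
    · exact Or.inl ⟨α, _, ⟨p, rfl⟩, h⟩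
    · exact Or.inr ⟨α, _, ⟨p, rfl⟩, h.symm⟩

lemma IsFstStep.elemStep {α : Φˣ} {p : Polynomial Φ} {θ ψ : PolyAut Φ}
    (h : IsFstStep α p θ ψ) : ElemStep θ ψ :=
  elemStep_iff.2 (Or.inl ⟨α, p, h⟩)

lemma ElemStep.swapAut {θ ψ : PolyAut Φ} (h : ElemStep θ ψ) :
    ElemStep (swapAut θ) (swapAut ψ) := by
  rw [elemStep_iff] at h ⊢
  simpa [or_comm] using h

lemma IsFstStep.trans {α β : Φˣ} {p q : Polynomial Φ} {θ ψ χ : PolyAut Φ}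
    (h : IsFstStep α p θ ψ) (h' : IsFstStep β q ψ χ) :
    IsFstStep (β * α) (Polynomial.C (β : Φ) * p + q) θ χ := by
  obtain ⟨h0, h1⟩ := h
  obtain ⟨h0', h1'⟩ := h'
  refine ⟨?_, h1'.trans h1⟩
  rw [h0', h0, h1]
  simp [algebraMap_eq]
  ring

lemma IsFstStep.symm {α : Φˣ} {p : Polynomial Φ} {θ ψ : PolyAut Φ}
    (h : IsFstStep α p θ ψ) : IsFstStep α⁻¹ (Polynomial.C (-(α⁻¹ : Φˣ) : Φ) * p) ψ θ := by
  obtain ⟨h0, h1⟩ := h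
  refine ⟨?_, h1.symm⟩
  have : (C ((α⁻¹ : Φˣ) : Φ) : MvPolynomial (Fin 2) Φ) * C (α : Φ) = 1 := by
    rw [← C_mul, Units.inv_mul, C_1]
  rw [h0, h1]
  simp only [map_mul, Polynomial.aeval_C, algebraMap_eq, map_neg]
  linear_combination -θ (X 0) * this

lemma ElemStep.symm {θ ψ : PolyAut Φ} (h : ElemStep θ ψ) : ElemStep ψ θ := by
  rw [elemStep_iff] at h ⊢
  rcases h with ⟨α, p, h⟩ | ⟨α, p, h⟩
  · exact Or.inl ⟨_, _, h.symm⟩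
  · exact Or.inr ⟨_, _, h.symm⟩

lemma IsFstStep.elemStep_of_common_source {α β : Φˣ} {p q : Polynomial Φ} {θ ψ χ : PolyAut Φ}
    (h : IsFstStep α p θ ψ) (h' : IsFstStep β q θ χ) : ElemStep ψ χ :=
  (h.symm.trans h').elemStep

lemma exists_isFstStep (α : Φˣ) (p : Polynomial Φ) (θ : PolyAut Φ) :
    ∃ ψ, IsFstStep α p θ ψ := by
  let f : MvPolynomial (Fin 2) Φ →ₐ[Φ] MvPolynomial (Fin 2) Φ :=
    aeval ![C (α : Φ) * X 0 + Polynomial.aeval (X 1) p, X 1]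
  let g : MvPolynomial (Fin 2) Φ →ₐ[Φ] MvPolynomial (Fin 2) Φ :=
    aeval ![C ((α⁻¹ : Φˣ) : Φ) * (X 0 - Polynomial.aeval (X 1) p), X 1]
  have hf0 : f (X 0) = C (α : Φ) * X 0 + Polynomial.aeval (X 1) p := by simp [f]
  have hf1 : f (X 1) = X 1 := by simp [f]
  have hg0 : g (X 0) = C ((α⁻¹ : Φˣ) : Φ) * (X 0 - Polynomial.aeval (X 1) p) := by simp [g]
  have hg1 : g (X 1) = X 1 := by simp [g]
  have hC (h : MvPolynomial (Fin 2) Φ →ₐ[Φ] MvPolynomial (Fin 2) Φ) (c : Φ) : h (C c) = C c :=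
    h.commutes c
  have hα : (C (α : Φ) : MvPolynomial (Fin 2) Φ) * C ((α⁻¹ : Φˣ) : Φ) = 1 := by
    rw [← C_mul, Units.mul_inv, C_1]
  have hfg : f.comp g = AlgHom.id Φ _ := by
    ext1 i
    fin_cases i
    · change f (g (X 0)) = X 0
      rw [hg0, map_mul, map_sub, hC, hf0, ← Polynomial.aeval_algHom_apply, hf1]
      linear_combination X 0 * hα
    · change f (g (X 1)) = X 1
      rw [hg1, hf1]
  have hgf : g.comp f = AlgHom.id Φ _ := by
    ext1 i
    fin_cases i
    · change g (f (X 0)) = X 0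
      rw [hf0, map_add, map_mul, hC, hg0, ← Polynomial.aeval_algHom_apply, hg1]
      linear_combination (X 0 - Polynomial.aeval (X 1) p) * hα
    · change g (f (X 1)) = X 1
      rw [hf1, hg1]
  refine ⟨(AlgEquiv.ofAlgHom f g hfg hgf).trans θ, ?_, ?_⟩
  · rw [AlgEquiv.trans_apply, AlgEquiv.ofAlgHom_apply, hf0, map_add, map_mul,
      ← Polynomial.aeval_algHom_apply]
    congr 2
    exact θ.commutes (α : Φ)
  · rw [AlgEquiv.trans_apply, AlgEquiv.ofAlgHom_apply, hf1]

lemma exists_isFstStep_swapAut (α : Φˣ) (p : Polynomial Φ) (θ : PolyAut Φ) :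
    ∃ ψ, IsFstStep α p (swapAut θ) (swapAut ψ) := by
  obtain ⟨ψ, h⟩ := exists_isFstStep α p (swapAut θ)
  exact ⟨swapAut ψ, by simpa using h⟩

/-- The `Φ`-submodule spanned by `f₁`, `f₂` and `1`, where `θ = (f₁, f₂)`. -/
noncomputable def coordSpan (θ : PolyAut Φ) : Submodule Φ (MvPolynomial (Fin 2) Φ) :=
  Submodule.span Φ {θ (X 0), θ (X 1), 1}

lemma mem_coordSpan {θ : PolyAut Φ} {f : MvPolynomial (Fin 2) Φ} :
    f ∈ coordSpan θ ↔ ∃ a b c : Φ, f = C a * θ (X 0) + C b * θ (X 1) + C c := by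
  simp only [coordSpan, Submodule.mem_span_triple, smul_eq_C_mul, mul_one, eq_comm]

lemma X_zero_mem_coordSpan (θ : PolyAut Φ) : θ (X 0) ∈ coordSpan θ :=
  mem_coordSpan.2 ⟨1, 0, 0, by simp⟩

lemma X_one_mem_coordSpan (θ : PolyAut Φ) : θ (X 1) ∈ coordSpan θ :=
  mem_coordSpan.2 ⟨0, 1, 0, by simp⟩

lemma coordSpan_swapAut (θ : PolyAut Φ) : coordSpan (swapAut θ) = coordSpan θ := by
  rw [coordSpan, coordSpan, swapAut_X_zero, swapAut_X_one, Set.insert_comm]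

lemma coordSpan_le {θ ψ : PolyAut Φ} (h0 : θ (X 0) ∈ coordSpan ψ)
    (h1 : θ (X 1) ∈ coordSpan ψ) : coordSpan θ ≤ coordSpan ψ := by
  rw [coordSpan, Submodule.span_le]
  rintro f (rfl | rfl | rfl)
  · exact h0
  · exact h1
  · exact mem_coordSpan.2 ⟨0, 0, 1, by simp⟩

lemma aeval_of_natDegree_le_one (f : MvPolynomial (Fin 2) Φ) {p : Polynomial Φ}
    (hp : p.natDegree ≤ 1) : Polynomial.aeval f p = C (p.coeff 1) * f + C (p.coeff 0) := by
  conv_lhs => rw [Polynomial.eq_X_add_C_of_natDegree_le_one hp]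
  simp [algebraMap_eq]

lemma aeval_of_natDegree_eq_zero (f : MvPolynomial (Fin 2) Φ) {p : Polynomial Φ}
    (hp : p.natDegree = 0) : Polynomial.aeval f p = C (p.coeff 0) := by
  conv_lhs => rw [Polynomial.eq_C_of_natDegree_eq_zero hp]
  simp [algebraMap_eq]

lemma IsFstStep.coordSpan_le {α : Φˣ} {p : Polynomial Φ} {θ ψ : PolyAut Φ}
    (h : IsFstStep α p θ ψ) (hp : p.natDegree ≤ 1) : coordSpan ψ ≤ coordSpan θ := by
  refine _root_.coordSpan_le ?_ (h.2 ▸ X_one_mem_coordSpan θ)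
  rw [h.1, aeval_of_natDegree_le_one _ hp, ← add_assoc]
  exact mem_coordSpan.2 ⟨_, _, _, rfl⟩

lemma IsFstStep.coordSpan_eq {α : Φˣ} {p : Polynomial Φ} {θ ψ : PolyAut Φ}
    (h : IsFstStep α p θ ψ) (hp : p.natDegree ≤ 1) : coordSpan ψ = coordSpan θ :=
  le_antisymm (h.coordSpan_le hp)
    (h.symm.coordSpan_le ((Polynomial.natDegree_C_mul_le _ _).trans hp))

lemma leadKey_le_of_mem_coordSpan {θ : PolyAut Φ} {f : MvPolynomial (Fin 2) Φ}
    (hf : f ∈ coordSpan θ) : leadKey f ≤ max (leadKey (θ (X 0))) (leadKey (θ (X 1))) := by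
  obtain ⟨a, b, c, rfl⟩ := mem_coordSpan.1 hf
  refine (leadKey_add_le _ _).trans (max_le ((leadKey_add_le _ _).trans ?_) ?_)
  · exact max_le_max (leadKey_C_mul_le _ _) (leadKey_C_mul_le _ _)
  · rw [leadKey_C]
    exact bot_le

lemma leadKey_X_ne_bot [Nontrivial Φ] (θ : PolyAut Φ) (i : Fin 2) : leadKey (θ (X i)) ≠ ⊥ := by
  intro h
  obtain ⟨c, hc⟩ := eq_C_of_leadKey_eq_bot h
  have h1 : θ (X i) = θ (C c) := hc.trans (θ.commutes c).symm
  have h2 := congrArg totalDegree (θ.injective h1)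
  simp at h2

lemma leadKey_C_lt_leadKey_X [Nontrivial Φ] (c : Φ) (θ : PolyAut Φ) (i : Fin 2) :
    leadKey (C c : MvPolynomial (Fin 2) Φ) < leadKey (θ (X i)) := by
  rw [leadKey_C]
  exact bot_lt_iff_ne_bot.2 (leadKey_X_ne_bot θ i)

lemma map_X_ne_zero [Nontrivial Φ] (θ : PolyAut Φ) (i : Fin 2) : θ (X i) ≠ 0 :=
  (map_ne_zero_iff θ θ.injective).2 (X_ne_zero i)

end Automorphisms

section Reduction

variable {Φ : Type*} [CommRing Φ] {ν : Φ → ℕ}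

lemma dAut_lt_of_le_leadKey {θ ψ : PolyAut Φ} (h1 : ψ (X 1) = θ (X 1))
    (hθ : leadKey (θ (X 0)) ≤ leadKey (θ (X 1))) (hψ : leadKey (θ (X 1)) ≤ leadKey (ψ (X 0)))
    (hlt : leadKey (θ (X 0)) < leadKey (ψ (X 0))) : DAut ν θ < DAut ν ψ := by
  rw [DAut, DAut, h1, max_eq_right hθ, min_eq_left hθ, max_eq_left hψ, min_eq_right hψ]
  rcases hψ.lt_or_eq with h | h
  · exact Prod.Lex.toLex_lt_toLex.2 (Or.inl h)
  · exact Prod.Lex.toLex_lt_toLex.2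
      (Or.inr ⟨h, Prod.Lex.toLex_lt_toLex.2 (Or.inl (h ▸ hlt))⟩)

lemma dAut_lt_of_leadKey_lt {θ ψ : PolyAut Φ} (h1 : ψ (X 1) = θ (X 1))
    (hlt : leadKey (ψ (X 0)) < leadKey (θ (X 0))) : DAut ν ψ < DAut ν θ := by
  rcases le_total (leadKey (θ (X 0))) (leadKey (θ (X 1))) with h | h
  · rw [DAut, DAut, h1, max_eq_right h, min_eq_left h, max_eq_right (hlt.le.trans h),
      min_eq_left (hlt.le.trans h)]
    exact Prod.Lex.toLex_lt_toLex.2 (Or.inr ⟨rfl, Prod.Lex.toLex_lt_toLex.2 (Or.inl hlt)⟩)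
  · rw [DAut, DAut, h1, max_eq_left h, min_eq_right h]
    rcases h.lt_or_eq with h' | h'
    · exact Prod.Lex.toLex_lt_toLex.2 (Or.inl (max_lt hlt h'))
    · refine Prod.Lex.toLex_lt_toLex.2 (Or.inr ⟨?_, Prod.Lex.toLex_lt_toLex.2 (Or.inl ?_)⟩)
      · simp only [h']
        exact max_eq_right hlt.le
      · simp only [h']
        exact min_lt_of_left_lt hlt

lemma dAut_lt_of_norm_lt {θ ψ : PolyAut Φ} (h1 : ψ (X 1) = θ (X 1))
    (h0 : leadKey (ψ (X 0)) = leadKey (θ (X 0))) (hlt : ν (lc (ψ (X 0))) < ν (lc (θ (X 0)))) :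
    DAut ν ψ < DAut ν θ := by
  rw [DAut, DAut, h0, h1]
  exact Prod.Lex.toLex_lt_toLex.2 (Or.inr ⟨rfl, Prod.Lex.toLex_lt_toLex.2
    (Or.inr ⟨rfl, Nat.add_lt_add_right hlt _⟩)⟩)

/-- An elementary transformation from `θ` to `ψ` that decreases `D`. -/
def ReductionStep (ν : Φ → ℕ) (θ ψ : PolyAut Φ) : Prop :=
  ElemStep θ ψ ∧ DAut ν ψ < DAut ν θ

/-- `θ` is linked to an automorphism with the minimal value of `D` by elementary transformations
decreasing `D`. -/
def IsReducible (ν : Φ → ℕ) (θ : PolyAut Φ) : Prop :=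
  ∃ ψ, Relation.ReflTransGen (ReductionStep ν) θ ψ ∧ DAut ν ψ = DId (ν 1)

lemma ReductionStep.swapAut {θ ψ : PolyAut Φ} (h : ReductionStep ν θ ψ) :
    ReductionStep ν (swapAut θ) (swapAut ψ) :=
  ⟨h.1.swapAut, by simpa only [dAut_swapAut] using h.2⟩

lemma IsReducible.swapAut {θ : PolyAut Φ} (h : IsReducible ν θ) : IsReducible ν (swapAut θ) := by
  obtain ⟨ψ, h, hψ⟩ := h
  exact ⟨_root_.swapAut ψ, h.lift _ fun _ _ => ReductionStep.swapAut, by rwa [dAut_swapAut]⟩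

lemma isReducible_swapAut_iff {θ : PolyAut Φ} :
    IsReducible ν (swapAut θ) ↔ IsReducible ν θ :=
  ⟨fun h => by simpa using h.swapAut, IsReducible.swapAut⟩

lemma IsReducible.head {θ ψ : PolyAut Φ} (h : Relation.ReflTransGen (ReductionStep ν) θ ψ)
    (hψ : IsReducible ν ψ) : IsReducible ν θ := by
  obtain ⟨χ, hχ, hD⟩ := hψ
  exact ⟨χ, h.trans hχ, hD⟩

lemma dAut_le_of_reflTransGen {θ ψ : PolyAut Φ}
    (h : Relation.ReflTransGen (ReductionStep ν) θ ψ) : DAut ν ψ ≤ DAut ν θ := by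
  induction h with
  | refl => exact le_rfl
  | tail _ h ih => exact h.2.le.trans ih

variable [IsDomain Φ]

lemma IsEuclideanNorm.norm_unit_mul (hν : IsEuclideanNorm Φ ν) (α : Φˣ) {a : Φ} (ha : a ≠ 0) :
    ν (α * a) = ν a := by
  rw [mul_comm]
  exact (hν.norm_eq_iff_unit a α ha α.ne_zero).2 α.isUnit

lemma IsEuclideanNorm.norm_one_le (hν : IsEuclideanNorm Φ ν) {a : Φ} (ha : a ≠ 0) :
    ν 1 ≤ ν a := by
  simpa using hν.norm_le 1 a one_ne_zero ha

/-- An elementary transformation of the smaller (or equal) component that does not increase `D`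
is given by a polynomial of degree at most `1`. -/
lemma IsFstStep.natDegree_le_one {α : Φˣ} {p : Polynomial Φ} {θ ψ : PolyAut Φ}
    (h : IsFstStep α p θ ψ) (hD : DAut ν ψ ≤ DAut ν θ)
    (hk : leadKey (θ (X 0)) ≤ leadKey (θ (X 1))) : p.natDegree ≤ 1 := by
  by_contra! hp
  have h1 := leadKey_lt_leadKey_aeval (leadKey_X_ne_bot θ 1) hp
  have h2 : leadKey (ψ (X 0)) = leadKey (Polynomial.aeval (θ (X 1)) p) := by
    rw [h.1, add_comm]
    exact leadKey_add_of_lt ((leadKey_C_mul_le _ _).trans_lt (hk.trans_lt h1))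
  rw [← h2] at h1
  exact hD.not_gt (dAut_lt_of_le_leadKey h.2 hk h1.le (hk.trans_lt h1))

lemma IsFstStep.natDegree_eq_zero {α : Φˣ} {p : Polynomial Φ} {θ ψ : PolyAut Φ}
    (h : IsFstStep α p θ ψ) (hD : DAut ν ψ ≤ DAut ν θ)
    (hk : leadKey (θ (X 0)) < leadKey (θ (X 1))) : p.natDegree = 0 := by
  by_contra! hp
  have h1 := leadKey_le_leadKey_aeval (leadKey_X_ne_bot θ 1) (Nat.one_le_iff_ne_zero.2 hp)
  have h2 : leadKey (ψ (X 0)) = leadKey (Polynomial.aeval (θ (X 1)) p) := by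
    rw [h.1, add_comm]
    exact leadKey_add_of_lt ((leadKey_C_mul_le _ _).trans_lt (hk.trans_le h1))
  rw [← h2] at h1
  exact hD.not_gt (dAut_lt_of_le_leadKey h.2 hk.le h1 (hk.trans_le h1))

/-- A transformation `f₁ ↦ α f₁ + g` with `g` of smaller leading monomial preserves `D`. -/
lemma IsFstStep.dAut_eq (hν : IsEuclideanNorm Φ ν) {α : Φˣ} {p : Polynomial Φ}
    {θ ψ : PolyAut Φ} (h : IsFstStep α p θ ψ)
    (hk : leadKey (Polynomial.aeval (θ (X 1)) p) < leadKey (θ (X 0))) :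
    DAut ν ψ = DAut ν θ := by
  rw [← leadKey_C_mul α.ne_zero (θ (X 0))] at hk
  have h0 : leadKey (ψ (X 0)) = leadKey (θ (X 0)) := by
    rw [h.1, leadKey_add_of_lt hk, leadKey_C_mul α.ne_zero]
  have h0' : lc (ψ (X 0)) = α * lc (θ (X 0)) := by
    rw [h.1, lc_add_of_lt hk, lc_C_mul α.ne_zero]
  rw [DAut, DAut, h0, h0', h.2, hν.norm_unit_mul α (lc_ne_zero (map_X_ne_zero θ 0))]

lemma IsFstStep.dAut_eq_of_natDegree_eq_zero (hν : IsEuclideanNorm Φ ν) {α : Φˣ}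
    {p : Polynomial Φ} {θ ψ : PolyAut Φ} (h : IsFstStep α p θ ψ) (hp : p.natDegree = 0) :
    DAut ν ψ = DAut ν θ := by
  refine h.dAut_eq hν ?_
  rw [aeval_of_natDegree_eq_zero _ hp]
  exact leadKey_C_lt_leadKey_X _ θ 0

/-- If the two leading monomials coincide, division with remainder of the leading coefficients
yields a reduction step that preserves the span of the components and `1`. -/
lemma exists_reductionStep_of_leadKey_eq (hν : IsEuclideanNorm Φ ν) (θ : PolyAut Φ)
    (hk : leadKey (θ (X 0)) = leadKey (θ (X 1))) (hle : ν (lc (θ (X 1))) ≤ ν (lc (θ (X 0)))) :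
    ∃ ψ, ReductionStep ν θ ψ ∧ coordSpan ψ = coordSpan θ := by
  obtain ⟨q, r, hqr, hr⟩ := hν.division (lc (θ (X 0))) (lc (θ (X 1)))
    (lc_ne_zero (map_X_ne_zero θ 1))
  have hdeg : (Polynomial.C (-q) * Polynomial.X).natDegree ≤ 1 :=
    (Polynomial.natDegree_C_mul_le _ _).trans Polynomial.natDegree_X_le
  obtain ⟨ψ, hψ⟩ := exists_isFstStep 1 (Polynomial.C (-q) * Polynomial.X) θ
  refine ⟨ψ, ⟨hψ.elemStep, ?_⟩, hψ.coordSpan_eq hdeg⟩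
  have hle' : leadKey (ψ (X 0)) ≤ leadKey (θ (X 0)) := by
    have := leadKey_le_of_mem_coordSpan (hψ.coordSpan_le hdeg (X_zero_mem_coordSpan ψ))
    rwa [← hk, max_self] at this
  have hcoeff : coeff (leadMon (θ (X 0))) (ψ (X 0)) = r := by
    have : ψ (X 0) = θ (X 0) - C q * θ (X 1) := by
      rw [hψ.1]
      simp [algebraMap_eq, sub_eq_add_neg]
    rw [this, coeff_sub, coeff_C_mul]
    nth_rewrite 2 [leadMon_eq_of_leadKey_eq hk]
    rw [← lc, ← lc, hqr]
    ring
  rcases hr with rfl | hr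
  · exact dAut_lt_of_leadKey_lt hψ.2
      (leadKey_lt_of_coeff_eq_zero (map_X_ne_zero ψ 0) hle' hcoeff)
  · by_cases hr0 : r = 0
    · exact dAut_lt_of_leadKey_lt hψ.2
        (leadKey_lt_of_coeff_eq_zero (map_X_ne_zero ψ 0) hle' (hcoeff.trans hr0))
    · have hkey := leadKey_eq_of_coeff_ne_zero hle' (hcoeff.trans_ne hr0)
      refine dAut_lt_of_norm_lt hψ.2 hkey ?_
      rw [lc, leadMon_eq_of_leadKey_eq hkey, hcoeff]
      exact hr.trans_le hle

lemma exists_reflTransGen_leadKey_ne (hν : IsEuclideanNorm Φ ν) (θ : PolyAut Φ) :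
    ∃ ψ, Relation.ReflTransGen (ReductionStep ν) θ ψ ∧ coordSpan ψ = coordSpan θ ∧
      leadKey (ψ (X 0)) ≠ leadKey (ψ (X 1)) := by
  induction hN : DAut ν θ using WellFoundedLT.induction generalizing θ with
  | ind N ih =>
  subst hN
  by_cases hk : leadKey (θ (X 0)) = leadKey (θ (X 1))
  · obtain ⟨ψ, hψ, hspan⟩ : ∃ ψ, ReductionStep ν θ ψ ∧ coordSpan ψ = coordSpan θ := by
      rcases le_total (ν (lc (θ (X 1)))) (ν (lc (θ (X 0)))) with h | h
      · exact exists_reductionStep_of_leadKey_eq hν θ hk h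
      · obtain ⟨ψ, hψ, hspan⟩ := exists_reductionStep_of_leadKey_eq hν (swapAut θ)
          (by simpa using hk.symm) (by simpa using h)
        exact ⟨swapAut ψ, by simpa using hψ.swapAut, by simpa [coordSpan_swapAut] using hspan⟩
    obtain ⟨χ, hχ, hspan', hne⟩ := ih _ hψ.2 ψ rfl
    exact ⟨χ, hχ.head hψ, hspan'.trans hspan, hne⟩
  · exact ⟨θ, .refl, rfl, hk⟩

/-- Two automorphisms with the same span of components and `1`, whose first components have the
larger leading monomials, differ by two elementary transformations, the first of which
preserves `D`. -/
lemma exists_elemStep_of_coordSpan_eq (hν : IsEuclideanNorm Φ ν) {θ ψ : PolyAut Φ}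
    (hspan : coordSpan θ = coordSpan ψ) (hθ : leadKey (θ (X 1)) < leadKey (θ (X 0)))
    (hψ : leadKey (ψ (X 1)) < leadKey (ψ (X 0))) :
    ∃ χ, ElemStep θ χ ∧ DAut ν χ = DAut ν θ ∧ ElemStep χ ψ := by
  have hkey : leadKey (θ (X 0)) = leadKey (ψ (X 0)) := by
    apply le_antisymm
    · exact (leadKey_le_of_mem_coordSpan (hspan ▸ X_zero_mem_coordSpan θ)).trans_eq
        (max_eq_left hψ.le)
    · exact (leadKey_le_of_mem_coordSpan (hspan.symm ▸ X_zero_mem_coordSpan ψ)).trans_eq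
        (max_eq_left hθ.le)
  have key {θ ψ : PolyAut Φ} (hspan : coordSpan θ = coordSpan ψ)
      (hθ : leadKey (θ (X 1)) < leadKey (θ (X 0))) (hψ : leadKey (ψ (X 1)) < leadKey (ψ (X 0)))
      (hkey : leadKey (θ (X 0)) = leadKey (ψ (X 0))) :
      (∃ a b c, ψ (X 0) = C a * θ (X 0) + C b * θ (X 1) + C c ∧
        lc (ψ (X 0)) = a * lc (θ (X 0))) ∧ ∃ b c, ψ (X 1) = C b * θ (X 1) + C c := by
    have hcoeff (a b c : Φ) : coeff (leadMon (θ (X 0)))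
        (C a * θ (X 0) + C b * θ (X 1) + C c) = a * lc (θ (X 0)) := by
      rw [coeff_add, coeff_add, coeff_C_mul, coeff_C_mul,
        coeff_eq_zero_of_leadKey_lt (f := θ (X 1)) (by rwa [mkey_leadMon]),
        coeff_eq_zero_of_leadKey_lt (f := C c)
          (by rw [mkey_leadMon]; exact leadKey_C_lt_leadKey_X c θ 0), lc]
      ring
    constructor
    · obtain ⟨a, b, c, h⟩ := mem_coordSpan.1 (hspan.symm ▸ X_zero_mem_coordSpan ψ)
      refine ⟨a, b, c, h, ?_⟩
      rw [lc, leadMon_eq_of_leadKey_eq hkey.symm, h, hcoeff]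
    · obtain ⟨a, b, c, h⟩ := mem_coordSpan.1 (hspan.symm ▸ X_one_mem_coordSpan ψ)
      have h0 : coeff (leadMon (θ (X 0))) (ψ (X 1)) = 0 :=
        coeff_eq_zero_of_leadKey_lt (by rwa [mkey_leadMon, hkey])
      rw [h, hcoeff] at h0
      have ha := (mul_eq_zero.1 h0).resolve_right (lc_ne_zero (map_X_ne_zero θ 0))
      exact ⟨b, c, by rw [h, ha]; simp⟩
  obtain ⟨⟨a, b, c, h0, ha⟩, d, e, h1⟩ := key hspan hθ hψ hkey
  obtain ⟨⟨a', b', c', h0', ha'⟩, d', e', h1'⟩ := key hspan.symm hψ hθ hkey.symm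
  have haa : a * a' = 1 := by
    rw [ha', ← mul_assoc] at ha
    exact (mul_right_cancel₀ (lc_ne_zero (map_X_ne_zero ψ 0)) (by rw [one_mul]; exact ha)).symm
  have hdd : d * d' = 1 := by
    have h2 : ψ (X 1) = C (d * d') * ψ (X 1) + C (d * e' + e) := by
      nth_rewrite 1 [h1]
      rw [h1']
      simp only [C_mul, C_add]
      ring
    have h3 := congrArg (coeff (leadMon (ψ (X 1)))) h2
    rw [coeff_add, coeff_C_mul, coeff_eq_zero_of_leadKey_lt (f := C _)
      (by rw [mkey_leadMon]; exact leadKey_C_lt_leadKey_X _ ψ 1), add_zero, ← lc] at h3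
    exact (mul_right_cancel₀ (lc_ne_zero (map_X_ne_zero ψ 1)) (by rw [one_mul]; exact h3)).symm
  obtain ⟨χ, hχ⟩ := exists_isFstStep_swapAut (Units.mkOfMulEqOne d d' hdd) (Polynomial.C e) θ
  refine ⟨χ, elemStep_iff.2 (Or.inr ⟨_, _, hχ⟩), ?_, ElemStep.symm ?_⟩
  · simpa only [dAut_swapAut] using hχ.dAut_eq_of_natDegree_eq_zero hν (Polynomial.natDegree_C e)
  · have hχ0 : χ (X 0) = θ (X 0) := by simpa using hχ.2
    have hχ1 : χ (X 1) = ψ (X 1) := by simpa [h1, algebraMap_eq] using hχ.1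
    refine IsFstStep.elemStep (α := Units.mkOfMulEqOne a' a (by rwa [mul_comm]))
      (p := Polynomial.C b' * Polynomial.X + Polynomial.C c') ⟨?_, hχ1⟩
    rw [hχ0, h0']
    simp [algebraMap_eq, add_assoc]

lemma isReducible_of_coordSpan_eq (hν : IsEuclideanNorm Φ ν) {θ φ ψ : PolyAut Φ}
    (ih : ∀ a, DAut ν a < DAut ν θ → IsReducible ν a → ∀ b, ElemStep a b → IsReducible ν b)
    (hφ : IsReducible ν φ) (hD : DAut ν φ < DAut ν θ) (hspan : coordSpan φ = coordSpan ψ) :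
    IsReducible ν ψ := by
  have reduce {a b : PolyAut Φ} (h : Relation.ReflTransGen (ReductionStep ν) a b)
      (ha : IsReducible ν a) (hDa : DAut ν a < DAut ν θ) : IsReducible ν b := by
    induction h with
    | refl => exact ha
    | tail hab hbc hb => exact ih _ ((dAut_le_of_reflTransGen hab).trans_lt hDa) hb _ hbc.1
  have key {a b : PolyAut Φ} (ha : IsReducible ν a) (hDa : DAut ν a < DAut ν θ)
      (hab : coordSpan a = coordSpan b) (hka : leadKey (a (X 1)) < leadKey (a (X 0)))
      (hkb : leadKey (b (X 1)) < leadKey (b (X 0))) : IsReducible ν b := by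
    obtain ⟨χ, h1, h2, h3⟩ := exists_elemStep_of_coordSpan_eq hν hab hka hkb
    exact ih χ (h2.trans_lt hDa) (ih a hDa ha χ h1) b h3
  have key' {a b : PolyAut Φ} (ha : IsReducible ν a) (hDa : DAut ν a < DAut ν θ)
      (hab : coordSpan a = coordSpan b) (hka : leadKey (a (X 1)) < leadKey (a (X 0)))
      (hkb : leadKey (b (X 0)) ≠ leadKey (b (X 1))) : IsReducible ν b := by
    rcases hkb.lt_or_gt with hkb | hkb
    · rw [← isReducible_swapAut_iff]
      exact key ha hDa (hab.trans (coordSpan_swapAut b).symm) hka (by simpa using hkb)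
    · exact key ha hDa hab hka hkb
  obtain ⟨φ', hφφ', hspanφ, hkφ⟩ := exists_reflTransGen_leadKey_ne hν φ
  obtain ⟨ψ', hψψ', hspanψ, hkψ⟩ := exists_reflTransGen_leadKey_ne hν ψ
  have hφ' := reduce hφφ' hφ hD
  have hD' := (dAut_le_of_reflTransGen hφφ').trans_lt hD
  have hspan' : coordSpan φ' = coordSpan ψ' := hspanφ.trans (hspan.trans hspanψ.symm)
  refine IsReducible.head hψψ' ?_
  rcases hkφ.lt_or_gt with h | h
  · exact key' hφ'.swapAut (by rwa [dAut_swapAut]) ((coordSpan_swapAut φ').trans hspan')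
      (by simpa using h) hkψ
  · exact key' hφ' hD' hspan' h hkψ

lemma IsFstStep.isReducible_of_elemStep (hν : IsEuclideanNorm Φ ν) {θ φ ψ : PolyAut Φ}
    (ih : ∀ a, DAut ν a < DAut ν θ → IsReducible ν a → ∀ b, ElemStep a b → IsReducible ν b)
    {α : Φˣ} {p : Polynomial Φ} (hθφ : IsFstStep α p θ φ) (hφ : IsReducible ν φ)
    (hDφ : DAut ν φ < DAut ν θ) (hθψ : ElemStep θ ψ) (hDψ : DAut ν ψ ≤ DAut ν θ) :
    IsReducible ν ψ := by
  rcases elemStep_iff.1 hθψ with ⟨β, q, h⟩ | ⟨β, q, h⟩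
  · exact ih φ hDφ hφ ψ (hθφ.elemStep_of_common_source h)
  have hDψ' : DAut ν (swapAut ψ) ≤ DAut ν (swapAut θ) := by simpa only [dAut_swapAut] using hDψ
  rcases lt_trichotomy (leadKey (θ (X 0))) (leadKey (θ (X 1))) with hk | hk | hk
  · exact absurd (hθφ.dAut_eq_of_natDegree_eq_zero hν (hθφ.natDegree_eq_zero hDφ.le hk)) hDφ.ne
  · refine isReducible_of_coordSpan_eq hν ih hφ hDφ ?_
    have h1 := hθφ.coordSpan_eq (hθφ.natDegree_le_one hDφ.le hk.le)
    have h2 := h.coordSpan_eq (h.natDegree_le_one hDψ' (by simpa using hk.ge))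
    rw [coordSpan_swapAut, coordSpan_swapAut] at h2
    exact h1.trans h2.symm
  · have hq := h.natDegree_eq_zero hDψ' (by simpa using hk)
    obtain ⟨χ, hχ⟩ := exists_isFstStep_swapAut β q φ
    have hψ1 : ψ (X 1) = C (β : Φ) * θ (X 1) + C (q.coeff 0) := by
      simpa [aeval_of_natDegree_eq_zero _ hq] using h.1
    have hψ0 : ψ (X 0) = θ (X 0) := by simpa using h.2
    have hχ1 : χ (X 1) = ψ (X 1) := by
      simpa [aeval_of_natDegree_eq_zero _ hq, hψ1, hθφ.2] using hχ.1
    have hχ0 : χ (X 0) = φ (X 0) := by simpa using hχ.2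
    have hDχ : DAut ν χ = DAut ν φ := by
      simpa only [dAut_swapAut] using hχ.dAut_eq_of_natDegree_eq_zero hν hq
    have hDψθ : DAut ν ψ = DAut ν θ := by
      simpa only [dAut_swapAut] using h.dAut_eq_of_natDegree_eq_zero hν hq
    have hstep : ElemStep χ ψ := by
      refine (IsFstStep.elemStep (α := α)
        (p := p.comp (Polynomial.C ((β⁻¹ : Φˣ) : Φ) *
          (Polynomial.X - Polynomial.C (q.coeff 0)))) ⟨?_, hχ1⟩).symm
      have : (C ((β⁻¹ : Φˣ) : Φ) : MvPolynomial (Fin 2) Φ) * C (β : Φ) = 1 := by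
        rw [← C_mul, Units.inv_mul, C_1]
      rw [hχ0, hψ0, hθφ.1, Polynomial.aeval_comp, hψ1]
      simp [algebraMap_eq, ← mul_assoc, this]
    refine IsReducible.head (.single ⟨hstep.symm, ?_⟩)
      (ih φ hDφ hφ χ (elemStep_iff.2 (Or.inr ⟨_, _, hχ⟩)))
    rw [hDχ, hDψθ]
    exact hDφ

/-- The value `(x₁, x₂, 2e)` is the minimum of `D`. -/
lemma dId_le_dAut (hν : IsEuclideanNorm Φ ν) (θ : PolyAut Φ) : DId (ν 1) ≤ DAut ν θ := by
  have hmin (i : Fin 2) : (toLex (1, 0) : ℕ ×ₗ ℕ) ≤ leadKey (θ (X i)) := by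
    have h := leadKey_X_ne_bot θ i
    rw [← mkey_leadMon, mkey, Prod.Lex.toLex_le_toLex]
    rw [← mkey_leadMon, ← mkey_zero, mkey_injective.ne_iff] at h
    by_contra! hc
    apply h
    ext j
    fin_cases j <;> simp <;> omega
  have hmax : (toLex (1, 1) : ℕ ×ₗ ℕ) ≤ max (leadKey (θ (X 0))) (leadKey (θ (X 1))) := by
    by_contra! hc
    have hpd (i : Fin 2) : pderiv 0 (θ (X i)) = 0 := by
      have hi : leadKey (θ (X i)) < toLex (1, 1) := by
        refine lt_of_le_of_lt ?_ hc
        fin_cases i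
        · exact le_max_left _ _
        · exact le_max_right _ _
      refine pderiv_eq_zero_of_notMem_vars fun hmem => ?_
      obtain ⟨d, hd, hd0⟩ := (mem_vars_iff_mem_support 0).1 hmem
      have := (Finset.le_sup (f := mkey) hd).trans_lt hi
      rw [mkey, Prod.Lex.toLex_lt_toLex] at this
      rw [Finsupp.mem_support_iff] at hd0
      simp only at this
      omega
    have hall (f : MvPolynomial (Fin 2) Φ) : pderiv 0 (θ f) = 0 := by
      induction f using MvPolynomial.induction_on with
      | C a =>
        have : θ (C a) = C a := θ.commutes a
        rw [this, pderiv_C]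
      | add f g hf hg => rw [map_add, map_add, hf, hg, add_zero]
      | mul_X f i hf => rw [map_mul, Derivation.leibniz, hf, hpd]; simp
    have h := hall (θ.symm (X 0))
    rw [AlgEquiv.apply_symm_apply, pderiv_X_self] at h
    exact one_ne_zero h
  have hnorm (i : Fin 2) := hν.norm_one_le (lc_ne_zero (map_X_ne_zero θ i))
  refine Prod.Lex.toLex_le_toLex.2 ?_
  refine hmax.lt_or_eq.imp id fun h => ⟨h, Prod.Lex.toLex_le_toLex.2 ?_⟩
  refine (le_min (hmin 0) (hmin 1)).lt_or_eq.imp id fun h' => ⟨h', ?_⟩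
  have := hnorm 0
  have := hnorm 1
  simp only
  omega

lemma IsReducible.of_elemStep (hν : IsEuclideanNorm Φ ν) {θ ψ : PolyAut Φ}
    (hθ : IsReducible ν θ) (h : ElemStep θ ψ) : IsReducible ν ψ := by
  induction hN : DAut ν θ using WellFoundedLT.induction generalizing θ ψ with
  | ind N ih =>
  subst hN
  replace ih : ∀ a, DAut ν a < DAut ν θ → IsReducible ν a → ∀ b, ElemStep a b →
      IsReducible ν b := fun a ha hra b hab => ih _ ha hra hab rfl
  rcases lt_or_ge (DAut ν θ) (DAut ν ψ) with hD | hD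
  · exact IsReducible.head (.single ⟨h.symm, hD⟩) hθ
  obtain ⟨χ, hχ, hDχ⟩ := hθ
  rcases hχ.cases_head with rfl | ⟨φ, hφ, hφχ⟩
  · exact ⟨ψ, .refl, le_antisymm (hD.trans_eq hDχ) (dId_le_dAut hν ψ)⟩
  · have hred : IsReducible ν φ := ⟨χ, hφχ, hDχ⟩
    rcases elemStep_iff.1 hφ.1 with ⟨α, p, hs⟩ | ⟨α, p, hs⟩
    · exact hs.isReducible_of_elemStep hν ih hred hφ.2 h hD
    · rw [← isReducible_swapAut_iff]
      exact hs.isReducible_of_elemStep hν (by simpa only [dAut_swapAut] using ih) hred.swapAut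
        hφ.swapAut.2 h.swapAut (by simpa only [dAut_swapAut] using hD)

end Reduction

section Tame

variable {Φ : Type*} [CommRing Φ]

lemma elemStep_one_iff {σ : PolyAut Φ} : ElemStep 1 σ ↔ IsElementary σ := Iff.rfl

lemma elemStep_mul_left_iff (χ : PolyAut Φ) {θ ψ : PolyAut Φ} :
    ElemStep (χ * θ) (χ * ψ) ↔ ElemStep θ ψ := by
  have hC (c : Φ) : χ (C c) = C c := χ.commutes c
  have key (α : Φˣ) (p : Polynomial Φ) (θ ψ : PolyAut Φ) :
      IsFstStep α p (χ * θ) (χ * ψ) ↔ IsFstStep α p θ ψ := by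
    simp only [IsFstStep, AlgEquiv.mul_apply]
    rw [Polynomial.aeval_algHom_apply, ← hC, ← map_mul, ← map_add, χ.injective.eq_iff,
      χ.injective.eq_iff, hC]
  have hswap (θ : PolyAut Φ) : swapAut (χ * θ) = χ * swapAut θ := polyAut_ext (by simp) (by simp)
  simp only [elemStep_iff, hswap, key]

lemma isElementary_mul_right_iff {θ σ : PolyAut Φ} :
    IsElementary σ ↔ ElemStep θ (θ * σ) := by
  rw [← elemStep_one_iff, ← elemStep_mul_left_iff θ, mul_one]

lemma ElemStep.mem_tameSubgroup {θ ψ : PolyAut Φ} (h : ElemStep θ ψ)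
    (hθ : θ ∈ TameSubgroup Φ) : ψ ∈ TameSubgroup Φ := by
  have : IsElementary (θ⁻¹ * ψ) := isElementary_mul_right_iff (θ := θ).2 (by simpa using h)
  simpa using mul_mem hθ (Subgroup.subset_closure this)

lemma swapAut_one_mem_tameSubgroup : swapAut 1 ∈ TameSubgroup Φ := by
  obtain ⟨a, ha⟩ := exists_isFstStep 1 Polynomial.X (1 : PolyAut Φ)
  obtain ⟨b, hb⟩ := exists_isFstStep_swapAut 1 (-Polynomial.X) a
  obtain ⟨c, hc⟩ := exists_isFstStep 1 Polynomial.X b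
  have hb' : ElemStep a b := elemStep_iff.2 (Or.inr ⟨_, _, hb⟩)
  simp only [IsFstStep, swapAut_X_zero, swapAut_X_one] at ha hb hc
  have h : ElemStep c (swapAut 1) := by
    refine elemStep_iff.2 (Or.inr ⟨-1, 0, ?_, ?_⟩)
    · simp [hc.2, hb.1, ha.1, ha.2]
    · simp [hc.1, hb.1, hb.2, ha.1, ha.2]
  exact h.mem_tameSubgroup ((IsFstStep.elemStep hc).mem_tameSubgroup
    (hb'.mem_tameSubgroup ((IsFstStep.elemStep ha).mem_tameSubgroup (one_mem _))))

lemma swapAut_mem_tameSubgroup {θ : PolyAut Φ} (hθ : θ ∈ TameSubgroup Φ) :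
    swapAut θ ∈ TameSubgroup Φ := by
  have : swapAut θ = θ * swapAut 1 := polyAut_ext (by simp) (by simp)
  rw [this]
  exact mul_mem hθ swapAut_one_mem_tameSubgroup

lemma eq_of_leadKey_le {f : MvPolynomial (Fin 2) Φ} (hf : leadKey f ≤ toLex (1, 1)) :
    f = C (coeff (Finsupp.single 0 1) f) * X 0 + C (coeff (Finsupp.single 1 1) f) * X 1 +
      C (coeff 0 f) := by
  ext d
  rw [coeff_add, coeff_add, coeff_C_mul, coeff_C_mul, coeff_X, coeff_X, coeff_C]
  by_cases hd : d 0 + d 1 ≤ 1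
  · obtain rfl | rfl | rfl : d = 0 ∨ d = Finsupp.single 0 1 ∨ d = Finsupp.single 1 1 := by
      simp only [Finsupp.ext_iff, Fin.forall_fin_two]
      simp
      omega
    all_goals simp [Finsupp.single_left_inj, eq_comm (a := (0 : Fin 2 →₀ ℕ))]
  · have h0 : coeff d f = 0 := coeff_eq_zero_of_leadKey_lt <| hf.trans_lt <|
      Prod.Lex.toLex_lt_toLex.2 (Or.inl (not_le.1 hd))
    rw [h0, if_neg, if_neg, if_neg] <;> first | simp | (rintro rfl; simp at hd)

lemma mem_tameSubgroup_of_leadKey_eq {θ : PolyAut Φ} (h0 : leadKey (θ (X 0)) = toLex (1, 1))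
    (h1 : leadKey (θ (X 1)) = toLex (1, 0)) (hu0 : IsUnit (lc (θ (X 0))))
    (hu1 : IsUnit (lc (θ (X 1)))) : θ ∈ TameSubgroup Φ := by
  have hlt : (toLex (1, 0) : ℕ ×ₗ ℕ) < toLex (1, 1) :=
    Prod.Lex.toLex_lt_toLex.2 (Or.inr ⟨rfl, Nat.one_pos⟩)
  have e0 := eq_of_leadKey_le h0.le
  have e1 := eq_of_leadKey_le (h1.trans_lt hlt).le
  have hz : coeff (Finsupp.single 0 1) (θ (X 1)) = 0 :=
    coeff_eq_zero_of_leadKey_lt (h1.trans_lt (by simpa [mkey] using hlt))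
  have l0 : lc (θ (X 0)) = coeff (Finsupp.single 0 1) (θ (X 0)) := by
    rw [lc, leadMon, h0]
    simp
  have l1 : lc (θ (X 1)) = coeff (Finsupp.single 1 1) (θ (X 1)) := by
    rw [lc, leadMon, h1]
    simp
  rw [← l0] at e0
  rw [hz, ← l1, C_0, zero_mul, zero_add] at e1
  obtain ⟨α, hα⟩ := hu0
  obtain ⟨β, hβ⟩ := hu1
  obtain ⟨ρ, hρ⟩ := exists_isFstStep α
    (Polynomial.C (coeff (Finsupp.single 1 1) (θ (X 0))) * Polynomial.X +
      Polynomial.C (coeff 0 (θ (X 0)))) (1 : PolyAut Φ)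
  have hstep : ElemStep ρ θ := by
    refine elemStep_iff.2 (Or.inr ⟨β, Polynomial.C (coeff 0 (θ (X 1))), ?_, ?_⟩)
    · rw [swapAut_X_zero, swapAut_X_zero, hρ.2, hβ, Polynomial.aeval_C, algebraMap_eq,
        AlgEquiv.one_apply]
      exact e1
    · rw [swapAut_X_one, swapAut_X_one, hρ.1, hα]
      refine e0.trans ?_
      simp [algebraMap_eq, add_assoc]
  exact hstep.mem_tameSubgroup (hρ.elemStep.mem_tameSubgroup (one_mem _))

variable {ν : Φ → ℕ}

lemma isReducible_iff_exists_chain {φ : PolyAut Φ} :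
    IsReducible ν φ ↔ ∃ (n : ℕ) (c : Fin (n + 1) → PolyAut Φ), c 0 = φ ∧
      (∀ i : Fin n, ReductionStep ν (c i.castSucc) (c i.succ)) ∧
      DAut ν (c (Fin.last n)) = DId (ν 1) := by
  constructor
  · rintro ⟨ψ, h, hψ⟩
    induction h using Relation.ReflTransGen.head_induction_on with
    | refl => exact ⟨0, fun _ => ψ, rfl, fun i => i.elim0, hψ⟩
    | @head θ χ h _ ih =>
      obtain ⟨n, c, hc0, hc, hlast⟩ := ih
      refine ⟨n + 1, Fin.cons θ c, rfl, fun i => ?_, ?_⟩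
      · refine Fin.cases ?_ (fun j => ?_) i
        · simpa [hc0] using h
        · simpa [← Fin.succ_castSucc] using hc j
      · simpa [← Fin.succ_last] using hlast
  · rintro ⟨n, c, rfl, hc, hlast⟩
    refine ⟨c (Fin.last n), ?_, hlast⟩
    refine Fin.induction (motive := fun i => Relation.ReflTransGen (ReductionStep ν) (c 0) (c i))
      .refl (fun i ih => ih.tail (hc i)) _

variable [IsDomain Φ]

lemma mem_tameSubgroup_of_dAut_eq (hν : IsEuclideanNorm Φ ν) {θ : PolyAut Φ}
    (h : DAut ν θ = DId (ν 1)) : θ ∈ TameSubgroup Φ := by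
  have hnorm (i : Fin 2) := hν.norm_one_le (lc_ne_zero (map_X_ne_zero θ i))
  simp only [DAut, DId, EmbeddingLike.apply_eq_iff_eq, Prod.mk.injEq] at h
  obtain ⟨hmax, hmin, hsum⟩ := h
  have hunit (i : Fin 2) : IsUnit (lc (θ (X i))) := by
    refine (hν.norm_eq_iff_unit 1 _ one_ne_zero (lc_ne_zero (map_X_ne_zero θ i))).1 ?_
    rw [one_mul]
    have := hnorm 0
    have := hnorm 1
    fin_cases i <;> simp only [Fin.zero_eta, Fin.mk_one] <;> omega
  rcases le_total (leadKey (θ (X 0))) (leadKey (θ (X 1))) with hk | hk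
  · rw [max_eq_right hk] at hmax
    rw [min_eq_left hk] at hmin
    rw [← swapAut_swapAut θ]
    exact swapAut_mem_tameSubgroup (mem_tameSubgroup_of_leadKey_eq (by simpa using hmax)
      (by simpa using hmin) (by simpa using hunit 1) (by simpa using hunit 0))
  · rw [max_eq_left hk] at hmax
    rw [min_eq_right hk] at hmin
    exact mem_tameSubgroup_of_leadKey_eq hmax hmin (hunit 0) (hunit 1)

lemma dAut_one : DAut ν (1 : PolyAut Φ) = DId (ν 1) := by
  have h0 : leadKey (X 0 : MvPolynomial (Fin 2) Φ) = toLex (1, 1) := by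
    simp [leadKey, support_X, mkey]
  have h1 : leadKey (X 1 : MvPolynomial (Fin 2) Φ) = toLex (1, 0) := by
    simp [leadKey, support_X, mkey]
  have hle : (toLex (1, 0) : ℕ ×ₗ ℕ) ≤ toLex (1, 1) :=
    Prod.Lex.toLex_le_toLex.2 (Or.inr ⟨rfl, zero_le⟩)
  simp [DAut, DId, AlgEquiv.one_apply, h0, h1, hle, lc, leadMon, two_mul]

lemma mem_tameSubgroup_iff_isReducible (hν : IsEuclideanNorm Φ ν) {φ : PolyAut Φ} :
    φ ∈ TameSubgroup Φ ↔ IsReducible ν φ := by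
  constructor
  · intro h
    induction h using Subgroup.closure_induction_right with
    | one => exact ⟨1, .refl, dAut_one⟩
    | mul_right θ _ σ hσ ih => exact ih.of_elemStep hν (isElementary_mul_right_iff.1 hσ)
    | mul_inv_cancel θ _ σ hσ ih =>
      refine ih.of_elemStep hν (ElemStep.symm ?_)
      simpa using (isElementary_mul_right_iff (θ := θ * σ⁻¹)).1 hσ
  · rintro ⟨ψ, h, hψ⟩
    induction h using Relation.ReflTransGen.head_induction_on with
    | refl => exact mem_tameSubgroup_of_dAut_eq hν hψ
    | head h _ ih => exact h.1.symm.mem_tameSubgroup ih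

end Tame

/-- Over a Euclidean ring `Φ`, an automorphism `φ` of `Φ[x₁,x₂]` is tame if and only if
there is a finite chain of elementary transformations `φ = φ₀ → φ₁ → ⋯ → φₙ` with
`D(φ₀) ≻ D(φ₁) ≻ ⋯ ≻ D(φₙ)` and `D(φₙ) = (x₁, x₂, 2e)`, where `e = ν 1`. -/
theorem tame_iff_reduction_chain
    (Φ : Type*) [CommRing Φ] [IsDomain Φ] (ν : Φ → ℕ) (hν : IsEuclideanNorm Φ ν)
    (φ : PolyAut Φ) :
    φ ∈ TameSubgroup Φ ↔
      ∃ (n : ℕ) (c : Fin (n + 1) → PolyAut Φ),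
        c 0 = φ ∧
        (∀ i : Fin n, ElemStep (c i.castSucc) (c i.succ) ∧
          DAut ν (c i.succ) < DAut ν (c i.castSucc)) ∧
        DAut ν (c (Fin.last n)) = DId (ν 1) := by
  exact (mem_tameSubgroup_iff_isReducible hν).trans isReducible_iff_exists_chain
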